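/- Let α ∈ ℝ, n ≥ 2, let Ω ⊂ ℝ² be an open disk (of arbitrary center and radius) with area |Ω|, and let u : (ℝ²)^n → ℂ be a smooth, totally symmetric function whose support is disjoint from the diagonal set 𝔻. Then ∫_{Ω^n} ∑_{j=1}^n |D_j u|² dx ≥ (n−1) · (0.477 · C_{α,n}²/|Ω|) · ∫_{Ω^n} |u|² dx. -/

import Mathlib

open MeasureTheory

noncomputable section

/-- Squared magnitude of the covariant derivative `D_j u` at configuration `x`;
the plane `ℝ²` is identified with `ℂ` (so `a^⊥ = I·a`, and the two components of a
vector field are the real and imaginary parts). -/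
def covSq (α : ℝ) {N : ℕ} (u : (Fin N → ℂ) → ℂ) (j : Fin N) (x : Fin N → ℂ) : ℝ :=
  let A : ℂ := (α : ℂ) * ∑ k ∈ Finset.univ.erase j,
    Complex.I * (x j - x k) / ((‖x j - x k‖ : ℂ) ^ 2)
  ‖-Complex.I * fderiv ℝ u x (Pi.single j 1) + (A.re : ℂ) * u x‖ ^ 2 +
    ‖-Complex.I * fderiv ℝ u x (Pi.single j Complex.I) + (A.im : ℂ) * u x‖ ^ 2

/-- The statistics constant `C_{α,N} = min_{p ∈ {0,…,N-2}} min_{q ∈ ℤ} |(2p+1)α - 2q|`. -/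
def statC (α : ℝ) (N : ℕ) : ℝ :=
  ⨅ p : Fin (N - 1), ⨅ q : ℤ, |(2 * ((p : ℕ) : ℝ) + 1) * α - 2 * (q : ℝ)|

/-- `N`-anyon wave function in the magnetic gauge (smooth compactly supported
form-core representative): totally symmetric with support away from the diagonals. -/
structure IsAnyonWF (N : ℕ) (u : (Fin N → ℂ) → ℂ) : Prop where
  smooth : ContDiff ℝ (⊤ : ℕ∞) u
  compactSupport : HasCompactSupport u
  symmetric : ∀ (σ : Equiv.Perm (Fin N)) (x : Fin N → ℂ), u (x ∘ σ) = u x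
  offDiagonal : ∀ x ∈ tsupport u, ∀ j k : Fin N, j ≠ k → x j ≠ x k

/-- One-particle density of an `N`-particle wave function. -/
def density (N : ℕ) (u : (Fin N → ℂ) → ℂ) (y : ℂ) : ℝ :=
  ∑ j : Fin N, ∫ z : {k : Fin N // k ≠ j} → ℂ,
    ‖u (fun k => if h : k = j then y else z ⟨k, h⟩)‖ ^ 2

open scoped Real in
/-- One-dimensional exchange inequality: a function on the circle of length `π` with magnetic potential `A` of
flux `π β` over a period has covariant energy at least `dist(β, 2ℤ)²`. -/
theorem sq_mul_integral_le_of_flux {v v' : ℝ → ℂ} {A : ℝ → ℝ} {β C : ℝ}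
    (hv : ∀ t, HasDerivAt v (v' t) t) (hv' : Continuous v') (hA : Continuous A)
    (hvp : v π = v 0)
    (hflux : ∫ t in (0 : ℝ)..π, A t = π * β)
    (hC0 : 0 ≤ C) (hC : ∀ q : ℤ, C ≤ |β - 2 * q|) :
    C ^ 2 * ∫ t in (0 : ℝ)..π, ‖v t‖ ^ 2 ≤
      ∫ t in (0 : ℝ)..π, ‖-Complex.I * v' t + (A t : ℂ) * v t‖ ^ 2 := by
  have hvc : Continuous v := continuous_iff_continuousAt.2 fun t => (hv t).continuousAt
  set H : ℝ → ℝ := fun t => ∫ s in (0 : ℝ)..t, (A s - β) with hHdef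
  have hAb : Continuous fun s => A s - β := hA.sub continuous_const
  have hH : ∀ t, HasDerivAt H (A t - β) t := fun t =>
    intervalIntegral.integral_hasDerivAt_right (hAb.intervalIntegrable _ _)
      hAb.aestronglyMeasurable.stronglyMeasurableAtFilter hAb.continuousAt
  have hHc : Continuous H := continuous_iff_continuousAt.2 fun t => (hH t).continuousAt
  set h : ℝ → ℂ := fun t => Complex.exp (Complex.I * H t) * v t with hhdef
  set h' : ℝ → ℂ := fun t =>
    Complex.exp (Complex.I * H t) * (v' t + Complex.I * ((A t : ℂ) - β) * v t) with hh'def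
  have hh : ∀ t, HasDerivAt h (h' t) t := by
    intro t
    have h1 : HasDerivAt (fun t => Complex.I * (H t : ℂ)) (Complex.I * ((A t - β : ℝ) : ℂ)) t :=
      ((hH t).ofReal_comp).const_mul _
    refine ((h1.cexp).mul (hv t)).congr_deriv ?_
    simp only [hh'def]; push_cast; ring
  have hnorm : ∀ t, ‖Complex.exp (Complex.I * (H t : ℂ))‖ = 1 := fun t => by
    rw [mul_comm, Complex.norm_exp_ofReal_mul_I]
  have hhc : Continuous h := continuous_iff_continuousAt.2 fun t => (hh t).continuousAt
  have hh'c : Continuous h' := by simp only [hh'def]; fun_prop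
  have hHπ : H π = 0 := by
    simp only [hHdef]
    rw [intervalIntegral.integral_sub (hA.intervalIntegrable _ _) (by simp), hflux]
    simp
  have hend : h π = h 0 := by
    have h0 : H 0 = 0 := by simp [hHdef]
    simp [hhdef, hHπ, h0, hvp]
  have hπ : (0 : ℝ) < π := Real.pi_pos
  set g : ℝ → ℂ := fun t => h' t + Complex.I * β * h t with hgdef
  have hgc : Continuous g := by simp only [hgdef]; fun_prop
  have hgn : ∀ t, ‖g t‖ = ‖-Complex.I * v' t + (A t : ℂ) * v t‖ := by
    intro t
    have : g t = Complex.exp (Complex.I * H t) *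
        (Complex.I * (-Complex.I * v' t + (A t : ℂ) * v t)) := by
      simp only [hgdef, hh'def, hhdef]
      linear_combination (Complex.exp (Complex.I * H t) * v' t) * Complex.I_mul_I
    rw [this, norm_mul, norm_mul, hnorm]; simp
  have hhn : ∀ t, ‖h t‖ = ‖v t‖ := fun t => by simp only [hhdef]; rw [norm_mul, hnorm, one_mul]
  have hcoef : ∀ m : ℤ, fourierCoeffOn hπ g m =
      Complex.I * ((β + 2 * m : ℝ) : ℂ) * fourierCoeffOn hπ h m := by
    intro m
    have h1 : fourierCoeffOn hπ g m =
        fourierCoeffOn hπ h' m + Complex.I * β * fourierCoeffOn hπ h m := by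
      simp only [fourierCoeffOn_eq_integral, hgdef]
      rw [mul_smul_comm, ← smul_add, ← intervalIntegral.integral_const_mul,
        ← intervalIntegral.integral_add]
      · congr 2
        funext t
        simp only [smul_eq_mul]; ring
      · apply Continuous.intervalIntegrable; fun_prop
      · apply Continuous.intervalIntegrable; fun_prop
    have h2 : fourierCoeffOn hπ h' m = Complex.I * (2 * m) * fourierCoeffOn hπ h m := by
      rcases eq_or_ne m 0 with rfl | hm
      · rw [fourierCoeffOn_eq_integral]
        simp only [neg_zero, fourier_zero, one_smul]
        rw [intervalIntegral.integral_eq_sub_of_hasDerivAt (fun t _ => hh t)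
          (hh'c.intervalIntegrable _ _), hend]
        simp
      · rw [fourierCoeffOn_of_hasDerivAt hπ hm (fun t _ => hh t) (hh'c.intervalIntegrable _ _),
          hend]
        have : (m : ℂ) ≠ 0 := by exact_mod_cast hm
        have h3 : (π : ℂ) ≠ 0 := by exact_mod_cast hπ.ne'
        have h4 := Complex.I_ne_zero
        push_cast
        field_simp
        ring
    rw [h1, h2]; push_cast; ring
  have hmem : ∀ {f : ℝ → ℂ}, Continuous f → MemLp f 2 (volume.restrict (Set.Ioc 0 π)) := by
    intro f hf
    exact (memLp_two_iff_integrable_sq_norm hf.aestronglyMeasurable).2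
      ((hf.norm.pow 2).integrableOn_Ioc)
  have s1 := hasSum_sq_fourierCoeffOn hπ (hmem hhc)
  have s2 := hasSum_sq_fourierCoeffOn hπ (hmem hgc)
  have hle := hasSum_le (fun m : ℤ => ?_) (s1.mul_left (C ^ 2)) s2
  · simp only [sub_zero, smul_eq_mul, hhn, hgn] at hle
    have hpi : 0 < π⁻¹ := inv_pos.2 hπ
    rw [mul_left_comm] at hle
    exact le_of_mul_le_mul_left hle hpi
  · simp only [hcoef m, norm_mul, Complex.norm_I, one_mul, mul_pow, Complex.norm_real]
    gcongr
    have := hC (-m)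
    push_cast at this
    rw [Real.norm_eq_abs]
    rwa [show β + 2 * (m : ℝ) = β - 2 * -(m : ℝ) by ring]

open scoped Real in
/-- The Cauchy kernel integrated over a circle around the origin: it detects whether `ζ` lies
inside the circle. -/
theorem integral_re_circleMap_div_sub {ρ : ℝ} (hρ : 0 < ρ) {ζ : ℂ} (hζ : ‖ζ‖ ≠ ρ) :
    ∫ t in (0 : ℝ)..2 * π, (circleMap 0 ρ t / (circleMap 0 ρ t - ζ)).re =
      if ‖ζ‖ < ρ then 2 * π else 0 := by
  have hne : ∀ t, circleMap 0 ρ t - ζ ≠ 0 := by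
    intro t h
    apply hζ
    rw [← sub_eq_zero.1 h, norm_circleMap_zero, abs_of_pos hρ]
  have hc : Continuous fun t => circleMap 0 ρ t / (circleMap 0 ρ t - ζ) :=
    (continuous_circleMap 0 ρ).div ((continuous_circleMap 0 ρ).sub continuous_const) hne
  have h1 : ∫ t in (0 : ℝ)..2 * π, circleMap 0 ρ t / (circleMap 0 ρ t - ζ) =
      -Complex.I * ∮ z in C(0, ρ), (z - ζ)⁻¹ := by
    rw [circleIntegral, ← intervalIntegral.integral_const_mul]
    congr 1
    funext t
    simp only [deriv_circleMap, smul_eq_mul]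
    rw [div_eq_mul_inv]
    linear_combination (circleMap 0 ρ t * (circleMap 0 ρ t - ζ)⁻¹) * Complex.I_mul_I
  have h2 : ∫ t in (0 : ℝ)..2 * π, (circleMap 0 ρ t / (circleMap 0 ρ t - ζ)).re =
      (∫ t in (0 : ℝ)..2 * π, circleMap 0 ρ t / (circleMap 0 ρ t - ζ)).re :=
    Complex.reCLM.intervalIntegral_comp_comm (hc.intervalIntegrable _ _)
  rw [h2, h1]
  split_ifs with h
  · rw [circleIntegral.integral_sub_inv_of_mem_ball (by simpa using h)]
    have : -Complex.I * (2 * π * Complex.I) = ((2 * π : ℝ) : ℂ) := by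
      push_cast
      linear_combination (-2 * π : ℂ) * Complex.I_mul_I
    rw [this, Complex.ofReal_re]
  · have h3 : ∀ z ∈ Metric.closedBall (0 : ℂ) ρ, z - ζ ≠ 0 := by
      intro z hz h0
      rw [sub_eq_zero] at h0
      subst h0
      have : ‖z‖ ≤ ρ := by simpa using hz
      exact h (lt_of_le_of_ne this hζ)
    rw [Complex.circleIntegral_eq_zero_of_differentiable_on_off_countable hρ.le
      Set.countable_empty]
    · simp
    · exact ContinuousOn.inv₀ (by fun_prop) h3
    · intro z hz
      exact DifferentiableAt.inv (by fun_prop) (h3 z (Metric.ball_subset_closedBall hz.1))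

/-- The covariant derivative `-i ∂_v F + (A · v) F` of a function of two points of the plane, in
the direction `v`, for a magnetic potential with components `A` and `B` on the two points. -/
def pairCovDeriv (A B : ℂ × ℂ → ℂ) (F : ℂ × ℂ → ℂ) (p v : ℂ × ℂ) : ℂ :=
  -Complex.I * fderiv ℝ F p v +
    (((starRingEnd ℂ (A p) * v.1).re + (starRingEnd ℂ (B p) * v.2).re : ℝ) : ℂ) * F p

/-- The anyonic potential felt by the first particle of a pair, in the presence of further
particles at `z l`, `l ∈ S`. -/
def anyonPot (α : ℝ) {ι : Type*} (S : Finset ι) (z : ι → ℂ) (p : ℂ × ℂ) : ℂ :=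
  α * (Complex.I * (p.1 - p.2) / (‖p.1 - p.2‖ : ℂ) ^ 2 +
    ∑ l ∈ S, Complex.I * (p.1 - z l) / (‖p.1 - z l‖ : ℂ) ^ 2)

theorem conj_I_mul_div_norm_sq (y : ℂ) :
    starRingEnd ℂ (Complex.I * y / (‖y‖ : ℂ) ^ 2) = -Complex.I * y⁻¹ := by
  rw [Complex.inv_def, map_div₀, map_mul, Complex.conj_I, map_pow, Complex.conj_ofReal,
    Complex.normSq_eq_norm_sq, div_eq_mul_inv]
  push_cast
  ring

theorem re_conj_anyonPot_mul {α : ℝ} {ι : Type*} (S : Finset ι) (z : ι → ℂ) (X : ℂ) {w : ℂ}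
    (hw : w ≠ 0) :
    (starRingEnd ℂ (anyonPot α S z (X + w, X - w)) * (Complex.I * w)).re =
      α * (1 / 2 + ∑ l ∈ S, (w / (w - (z l - X))).re) := by
  have h : starRingEnd ℂ (anyonPot α S z (X + w, X - w)) * (Complex.I * w) =
      (α : ℂ) * (1 / 2 + ∑ l ∈ S, w / (w - (z l - X))) := by
    simp only [anyonPot, map_mul, map_add, map_sum, conj_I_mul_div_norm_sq, Complex.conj_ofReal]
    rw [mul_assoc, add_mul, Finset.sum_mul]
    congr 2
    · rw [show X + w - (X - w) = 2 * w by ring, mul_inv]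
      have h2 : w⁻¹ * w = 1 := inv_mul_cancel₀ hw
      linear_combination (-(2 : ℂ)⁻¹ * (w⁻¹ * w)) * Complex.I_mul_I + (2 : ℂ)⁻¹ * h2
    · refine Finset.sum_congr rfl fun l _ => ?_
      rw [show X + w - z l = w - (z l - X) by ring, div_eq_mul_inv]
      linear_combination (-(w * (w - (z l - X))⁻¹)) * Complex.I_mul_I
  rw [h, Complex.re_ofReal_mul, Complex.add_re, Complex.re_sum]
  norm_num

open scoped Real in
/-- Exchanging two particles along a circle around their midpoint costs angular energy. -/
theorem lintegral_circle_exchange {α C : ℝ} {ι : Type*} (S : Finset ι) (z : ι → ℂ)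
    {F : ℂ × ℂ → ℂ} (hF : ContDiff ℝ 1 F) (hsymm : ∀ p : ℂ × ℂ, F p.swap = F p)
    (hC0 : 0 ≤ C) (hC : ∀ m ≤ S.card, ∀ q : ℤ, C ≤ |(2 * (m : ℝ) + 1) * α - 2 * q|)
    (X : ℂ) {ρ : ℝ} (hρ : 0 < ρ) (hz : ∀ l ∈ S, ‖z l - X‖ ≠ ρ) :
    ∫⁻ t in Set.Ioo (-π) π,
        ENNReal.ofReal (C ^ 2 * ‖F (X + circleMap 0 ρ t, X - circleMap 0 ρ t)‖ ^ 2) ≤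
      ∫⁻ t in Set.Ioo (-π) π, ENNReal.ofReal
        (‖pairCovDeriv (anyonPot α S z) (fun p => anyonPot α S z p.swap) F
          (X + circleMap 0 ρ t, X - circleMap 0 ρ t)
          (Complex.I * circleMap 0 ρ t, -(Complex.I * circleMap 0 ρ t))‖ ^ 2) := by
  have hπ := Real.pi_pos
  set w : ℝ → ℂ := circleMap 0 ρ with hwdef
  have hwc : Continuous w := continuous_circleMap 0 ρ
  have hw0 : ∀ t, w t ≠ 0 := fun t => circleMap_ne_center hρ.ne'
  have hwπ : ∀ t, w (t + π) = -w t := by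
    intro t
    simp only [hwdef, circleMap]
    push_cast
    rw [add_mul, Complex.exp_add, Complex.exp_pi_mul_I]
    ring
  have hwn : ∀ t, ‖w t‖ = ρ := fun t => by rw [hwdef, norm_circleMap_zero, abs_of_pos hρ]
  have hne : ∀ l ∈ S, ∀ t, w t - (z l - X) ≠ 0 := by
    intro l hl t h
    apply hz l hl
    rw [← sub_eq_zero.1 h, hwn]
  set G : ℝ → ℝ := fun t => ∑ l ∈ S, (w t / (w t - (z l - X))).re with hGdef
  have hGc : Continuous G := by
    refine continuous_finsetSum _ fun l hl => Complex.continuous_re.comp ?_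
    exact hwc.div (hwc.sub continuous_const) (hne l hl)
  set A : ℝ → ℝ := fun t => α * (1 + (G t + G (t + π))) with hAdef
  have hAc : Continuous A := by simp only [hAdef]; fun_prop
  set P : ℝ → ℂ × ℂ := fun t => (X + w t, X - w t) with hPdef
  set V : ℝ → ℂ × ℂ := fun t => (Complex.I * w t, -(Complex.I * w t)) with hVdef
  have hP : ∀ t, HasDerivAt P (V t) t := by
    intro t
    have h1 : HasDerivAt w (Complex.I * w t) t := by
      have := hasDerivAt_circleMap 0 ρ t
      rwa [mul_comm] at this
    exact (h1.const_add X).prodMk (h1.const_sub X)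
  have hPc : Continuous P := by simp only [hPdef]; fun_prop
  have hVc : Continuous V := by simp only [hVdef]; fun_prop
  set v : ℝ → ℂ := fun t => F (P t) with hvdef
  set v' : ℝ → ℂ := fun t => fderiv ℝ F (P t) (V t) with hv'def
  have hv : ∀ t, HasDerivAt v (v' t) t := fun t =>
    ((hF.differentiable one_ne_zero (P t)).hasFDerivAt).comp_hasDerivAt t (hP t)
  have hv'c : Continuous v' := ((hF.continuous_fderiv one_ne_zero).comp hPc).clm_apply hVc
  have hvc : Continuous v := hF.continuous.comp hPc
  have hPπ : ∀ t, P (t + π) = (P t).swap := by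
    intro t; simp only [hPdef, hwπ, Prod.swap_prod_mk]; ext <;> simp [sub_eq_add_neg]
  have hvp : Function.Periodic v π := fun t => by simp only [hvdef, hPπ, hsymm]
  have hD : ∀ t, pairCovDeriv (anyonPot α S z) (fun p => anyonPot α S z p.swap) F (P t) (V t) =
      -Complex.I * v' t + (A t : ℂ) * v t := by
    intro t
    have e1 : (starRingEnd ℂ (anyonPot α S z (P t)) * (V t).1).re = α * (1 / 2 + G t) :=
      re_conj_anyonPot_mul S z X (hw0 t)
    have e2 : (starRingEnd ℂ (anyonPot α S z (P t).swap) * (V t).2).re =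
        α * (1 / 2 + G (t + π)) := by
      have := re_conj_anyonPot_mul (α := α) S z X (hw0 (t + π))
      rw [← hPπ]
      convert this using 3
      simp only [hVdef, hwπ]; ring
    rw [pairCovDeriv, e1, e2]
    simp only [hAdef, hv'def, hvdef]
    push_cast
    ring
  have hGp : Function.Periodic G (2 * π) := by
    intro t
    simp only [hGdef, hwdef, periodic_circleMap 0 ρ t]
  have hGint : ∫ t in (0 : ℝ)..2 * π, G t =
      2 * π * ((S.filter fun l => ‖z l - X‖ < ρ).card : ℝ) := by
    simp only [hGdef]
    rw [intervalIntegral.integral_finsetSum]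
    · rw [Finset.sum_congr rfl fun l hl => integral_re_circleMap_div_sub hρ (hz l hl)]
      rw [← Finset.sum_filter, Finset.sum_const, nsmul_eq_mul, mul_comm]
    · intro l hl
      refine Continuous.intervalIntegrable (Complex.continuous_re.comp ?_) _ _
      exact hwc.div (hwc.sub continuous_const) (hne l hl)
  set m := (S.filter fun l => ‖z l - X‖ < ρ).card with hm
  have hflux : ∫ t in (0 : ℝ)..π, A t = π * ((2 * (m : ℝ) + 1) * α) := by
    simp only [hAdef]
    rw [intervalIntegral.integral_const_mul, intervalIntegral.integral_add (by simp)
      (Continuous.intervalIntegrable (by fun_prop) _ _),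
      intervalIntegral.integral_add (hGc.intervalIntegrable _ _)
      (Continuous.intervalIntegrable (by fun_prop) _ _),
      intervalIntegral.integral_comp_add_right (fun t => G t),
      zero_add, ← two_mul, intervalIntegral.integral_add_adjacent_intervals
        (hGc.intervalIntegrable _ _) (hGc.intervalIntegrable _ _), hGint]
    simp
    ring
  have key := sq_mul_integral_le_of_flux hv hv'c hAc (by simpa using hvp 0) hflux hC0
    (hC m (Finset.card_filter_le _ _))
  have hAp : Function.Periodic A π := by
    intro t
    have : G (t + π + π) = G t := by rw [add_assoc, ← two_mul, hGp]
    simp only [hAdef, this]; ring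
  set e : ℝ → ℝ := fun t => ‖-Complex.I * v' t + (A t : ℂ) * v t‖ ^ 2 with hedef
  have hec : Continuous e := by simp only [hedef]; fun_prop
  have hv'p : Function.Periodic v' π := by
    intro t
    have h1 : HasDerivAt (fun s => v (s + π)) (v' (t + π)) t := (hv (t + π)).comp_add_const t π
    have h2 : (fun s => v (s + π)) = v := funext hvp
    rw [h2] at h1
    exact h1.unique (hv t)
  have hep : Function.Periodic e π := fun t => by simp only [hedef, hv'p t, hvp t, hAp t]
  set k : ℝ → ℝ := fun t => C ^ 2 * ‖v t‖ ^ 2 with hkdef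
  have hkc : Continuous k := by simp only [hkdef]; fun_prop
  have hkp : Function.Periodic k π := fun t => by simp only [hkdef, hvp t]
  have hk0 : ∀ t, 0 ≤ k t := fun t => by simp only [hkdef]; positivity
  have he0 : ∀ t, 0 ≤ e t := fun t => by simp only [hedef]; positivity
  have hdouble : ∀ {f : ℝ → ℝ}, Continuous f → Function.Periodic f π →
      ∫ t in (-π)..π, f t = 2 * ∫ t in (0 : ℝ)..π, f t := by
    intro f hf hfp
    rw [← intervalIntegral.integral_add_adjacent_intervals (hf.intervalIntegrable (-π) 0)
      (hf.intervalIntegrable 0 π)]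
    have := hfp.intervalIntegral_add_eq (-π) 0
    simp only [neg_add_cancel, zero_add] at this
    rw [this]; ring
  have hlint : ∀ {f : ℝ → ℝ}, Continuous f → (∀ t, 0 ≤ f t) →
      ∫⁻ t in Set.Ioo (-π) π, ENNReal.ofReal (f t) = ENNReal.ofReal (∫ t in (-π)..π, f t) := by
    intro f hf hf0
    rw [intervalIntegral.integral_of_le (by linarith), restrict_Ioo_eq_restrict_Ioc,
      ofReal_integral_eq_lintegral_ofReal hf.integrableOn_Ioc (ae_of_all _ hf0)]
  have hre : ∀ t, ‖pairCovDeriv (anyonPot α S z) (fun p => anyonPot α S z p.swap) F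
      (X + w t, X - w t) (Complex.I * w t, -(Complex.I * w t))‖ ^ 2 = e t := fun t => by
    simp only [hedef, ← hD]; rfl
  simp only [hre]
  rw [hlint hec he0, show (∫⁻ t in Set.Ioo (-π) π, ENNReal.ofReal
    (C ^ 2 * ‖F (X + w t, X - w t)‖ ^ 2)) = ENNReal.ofReal (∫ t in (-π)..π, k t) from
      hlint hkc hk0]
  apply ENNReal.ofReal_le_ofReal
  rw [hdouble hec hep, hdouble hkc hkp]
  have : ∫ t in (0 : ℝ)..π, k t = C ^ 2 * ∫ t in (0 : ℝ)..π, ‖v t‖ ^ 2 := by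
    simp only [hkdef]; rw [intervalIntegral.integral_const_mul]
  rw [this]
  linarith

open scoped Real in
/-- Integration over pairs of points of the plane in terms of the midpoint and of polar coordinates
for the separation. -/
theorem lintegral_midpoint_polar {H : ℂ × ℂ → ENNReal} (hH : Measurable H) :
    ∫⁻ p, H p = ∫⁻ X : ℂ, ∫⁻ ρ in Set.Ioi (0 : ℝ), ∫⁻ t in Set.Ioo (-π) π,
      ENNReal.ofReal ρ * H (X + circleMap 0 (ρ / 2) t, X - circleMap 0 (ρ / 2) t) := by
  calc ∫⁻ p, H p = ∫⁻ b : ℂ, ∫⁻ a : ℂ, H (a, b) := by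
        rw [Measure.volume_eq_prod, lintegral_prod_symm' _ hH]
    _ = ∫⁻ b : ℂ, ∫⁻ r : ℂ, H (r + b, b) := by
        congr 1
        funext b
        exact (lintegral_add_right_eq_self (fun a => H (a, b)) b).symm
    _ = ∫⁻ r : ℂ, ∫⁻ b : ℂ, H (r + b, b) :=
        lintegral_lintegral_swap (by apply Measurable.aemeasurable; fun_prop)
    _ = ∫⁻ r : ℂ, ∫⁻ X : ℂ, H (X + r / 2, X - r / 2) := by
        congr 1
        funext r
        rw [← lintegral_add_right_eq_self (fun b => H (r + b, b)) (-(r / 2))]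
        congr 1
        funext X
        congr 2; ring
    _ = ∫⁻ X : ℂ, ∫⁻ r : ℂ, H (X + r / 2, X - r / 2) :=
        lintegral_lintegral_swap (by apply Measurable.aemeasurable; fun_prop)
    _ = _ := by
        congr 1
        funext X
        have hm : Measurable fun r : ℂ => H (X + r / 2, X - r / 2) := by fun_prop
        have hm' : Measurable fun p : ℝ × ℝ => ENNReal.ofReal p.1 *
            H (X + circleMap 0 (p.1 / 2) p.2, X - circleMap 0 (p.1 / 2) p.2) := by
          have : Measurable fun p : ℝ × ℝ => circleMap 0 (p.1 / 2) p.2 := by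
            simp only [circleMap]; fun_prop
          fun_prop
        rw [← Complex.lintegral_comp_polarCoord_symm]
        have e : ∀ p : ℝ × ℝ, Complex.polarCoord.symm p / 2 = circleMap 0 (p.1 / 2) p.2 := by
          intro p
          rw [Complex.polarCoord_symm_apply, circleMap, Complex.exp_mul_I]
          push_cast
          ring
        simp only [e, smul_eq_mul]
        rw [polarCoord_target, Measure.volume_eq_prod, ← Measure.prod_restrict,
          lintegral_prod _ hm'.aemeasurable]

/-- The weight `1 / (2 |w|²)`, `w` the half separation of a pair, restricted to those pairs whose
exchange circle lies within distance `R` of the origin. -/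
def exchangeWeight (R : ℝ) (p : ℂ × ℂ) : ENNReal :=
  if ‖(p.1 + p.2) / 2‖ + ‖(p.1 - p.2) / 2‖ < R then
    ENNReal.ofReal (1 / (2 * ‖(p.1 - p.2) / 2‖ ^ 2)) else 0

theorem measurable_exchangeWeight (R : ℝ) : Measurable (exchangeWeight R) := by
  refine Measurable.ite ?_ (by fun_prop) measurable_const
  exact measurableSet_lt (by fun_prop) measurable_const

theorem measurable_pairCovDeriv {A B F : ℂ × ℂ → ℂ} (hA : Measurable A) (hB : Measurable B)
    (hF : ContDiff ℝ 1 F) {V : ℂ × ℂ → ℂ × ℂ} (hV : Continuous V) :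
    Measurable fun p => pairCovDeriv A B F p (V p) := by
  have h1 : Measurable fun p => fderiv ℝ F p (V p) :=
    ((hF.continuous_fderiv one_ne_zero).clm_apply hV).measurable
  have h2 : Measurable F := hF.continuous.measurable
  have h3 : Measurable V := hV.measurable
  have h4 : Measurable fun z : ℂ => starRingEnd ℂ z := Complex.continuous_conj.measurable
  simp only [pairCovDeriv]
  fun_prop

theorem measurable_anyonPot (α : ℝ) {ι : Type*} (S : Finset ι) (z : ι → ℂ) :
    Measurable (anyonPot α S z) := by
  unfold anyonPot
  refine Measurable.const_mul ?_ _
  refine Measurable.add (by fun_prop) (Finset.measurable_fun_sum _ fun l _ => by fun_prop)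

open scoped Real in
/-- Hardy-type inequality: the angular energy of exchanging a pair dominates an inverse-square
potential in the separation of the pair. -/
theorem lintegral_exchange_hardy {α C : ℝ} {ι : Type*} (S : Finset ι) (z : ι → ℂ)
    {F : ℂ × ℂ → ℂ} (hF : ContDiff ℝ 1 F) (hsymm : ∀ p : ℂ × ℂ, F p.swap = F p)
    (hC0 : 0 ≤ C) (hC : ∀ m ≤ S.card, ∀ q : ℤ, C ≤ |(2 * (m : ℝ) + 1) * α - 2 * q|) (R : ℝ) :
    ∫⁻ p, exchangeWeight R p * ENNReal.ofReal (C ^ 2 * ‖F p‖ ^ 2) ≤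
      ∫⁻ p, exchangeWeight R p * ENNReal.ofReal
        (‖pairCovDeriv (anyonPot α S z) (fun p => anyonPot α S z p.swap) F p
          (Complex.I * ((p.1 - p.2) / 2), -(Complex.I * ((p.1 - p.2) / 2)))‖ ^ 2) := by
  have hW := measurable_exchangeWeight R
  have hFm : Measurable F := hF.continuous.measurable
  have hA := measurable_anyonPot α S z
  have hD := measurable_pairCovDeriv hA (hA.comp measurable_swap) hF
    (V := fun p => (Complex.I * ((p.1 - p.2) / 2), -(Complex.I * ((p.1 - p.2) / 2))))
    (by fun_prop)
  have hD' : Measurable fun p => ENNReal.ofReal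
      (‖pairCovDeriv (anyonPot α S z) (fun p => anyonPot α S z p.swap) F p
          (Complex.I * ((p.1 - p.2) / 2), -(Complex.I * ((p.1 - p.2) / 2)))‖ ^ 2) :=
    ((hD.norm).pow_const 2).ennreal_ofReal
  have m₁ : Measurable fun p => exchangeWeight R p * ENNReal.ofReal (C ^ 2 * ‖F p‖ ^ 2) :=
    hW.mul (by fun_prop)
  have m₂ := hW.mul hD'
  simp only [Pi.mul_def] at m₂
  rw [lintegral_midpoint_polar m₁, lintegral_midpoint_polar m₂]
  refine lintegral_mono fun X => lintegral_mono_ae ?_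
  have hfin : ((fun l => 2 * ‖z l - X‖) '' (S : Set ι)).Finite := S.finite_toSet.image _
  have hnull : ∀ᵐ ρ ∂volume.restrict (Set.Ioi (0 : ℝ)), ρ ∉ (fun l => 2 * ‖z l - X‖) '' (S : Set ι) :=
    ae_restrict_of_ae (measure_eq_zero_iff_ae_notMem.1 (hfin.measure_zero _))
  filter_upwards [hnull, ae_restrict_mem measurableSet_Ioi] with ρ hρS hρ
  have hρ0 : 0 < ρ := hρ
  have hcirc := lintegral_circle_exchange S z hF hsymm hC0 hC X (half_pos hρ0) (by
    intro l hl h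
    exact hρS ⟨l, hl, by simp only [h]; ring⟩)
  set K : ENNReal := if ‖X‖ + ρ / 2 < R then ENNReal.ofReal (1 / (2 * (ρ / 2) ^ 2)) else 0 with hK
  have hKtop : K ≠ ⊤ := by rw [hK]; split_ifs <;> simp
  have e1 : ∀ t, (X + circleMap 0 (ρ / 2) t + (X - circleMap 0 (ρ / 2) t)) / 2 = X := by
    intro t; ring
  have e2 : ∀ t, (X + circleMap 0 (ρ / 2) t - (X - circleMap 0 (ρ / 2) t)) / 2 =
      circleMap 0 (ρ / 2) t := by
    intro t; ring
  have hWK : ∀ t, exchangeWeight R (X + circleMap 0 (ρ / 2) t, X - circleMap 0 (ρ / 2) t) = K := by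
    intro t
    simp only [exchangeWeight, e1, e2, norm_circleMap_zero, abs_of_pos (half_pos hρ0), hK]
  simp only [hWK, e2, ← mul_assoc]
  have htop : ENNReal.ofReal ρ * K ≠ ⊤ := ENNReal.mul_ne_top ENNReal.ofReal_ne_top hKtop
  rw [lintegral_const_mul' _ _ htop, lintegral_const_mul' _ _ htop]
  gcongr

theorem ofReal_integral_le_lintegral_ofReal {X : Type*} [MeasurableSpace X] {μ : Measure X}
    {f : X → ℝ} (hf : Integrable f μ) :
    ENNReal.ofReal (∫ x, f x ∂μ) ≤ ∫⁻ x, ENNReal.ofReal (f x) ∂μ := by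
  have h : ∫ x, f x ∂μ ≤ ∫ x, max (f x) 0 ∂μ :=
    integral_mono hf hf.pos_part fun x => le_max_left _ _
  refine (ENNReal.ofReal_le_ofReal h).trans ?_
  rw [ofReal_integral_eq_lintegral_ofReal hf.pos_part (ae_of_all _ fun x => le_max_right _ _)]
  refine lintegral_mono fun x => ?_
  rcases le_total (f x) 0 with h | h <;> simp [h]

theorem mul_le_kinetic_add {s q q' d ψ : ℝ} (hs : 0 < s) (hq : 0 ≤ q) (hd : |q'| ≤ 2 * √q * d)
    (hψ : 0 ≤ ψ) : ψ * q' ≤ d ^ 2 / 2 * s ^ 3 + 2 * ψ ^ 2 * q / s ^ 3 := by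
  have h1 : ψ * q' ≤ ψ * (2 * √q * d) :=
    mul_le_mul_of_nonneg_left ((le_abs_self _).trans hd) hψ
  have h3 : √q ^ 2 = q := Real.sq_sqrt hq
  have h4 : d ^ 2 / 2 * s ^ 3 + 2 * ψ ^ 2 * √q ^ 2 / s ^ 3 - ψ * (2 * √q * d) =
      (d * s ^ 3 - 2 * ψ * √q) ^ 2 / (2 * s ^ 3) := by
    field_simp
    ring
  have h5 : 0 ≤ (d * s ^ 3 - 2 * ψ * √q) ^ 2 / (2 * s ^ 3) := by positivity
  rw [h3] at h4
  linarith

theorem ray_inner_bound {R C s q q' d : ℝ} (hR : 0 < R) (hC0 : 0 ≤ C) (hC1 : C ≤ 1)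
    (hs : 0 < s) (hsR : 2 * s ^ 2 ≤ R ^ 2) (hq : 0 ≤ q) (hd : |q'| ≤ 2 * √q * d) :
    0.3 * C ^ 2 * s * q + 0.15 * C ^ 2 * s ^ 2 * q' + 0.3037 * C ^ 2 / R ^ 2 * q * s ^ 3 ≤
      (d ^ 2 / 2 + C ^ 2 / (2 * s ^ 2) * q) * s ^ 3 := by
  have hy := mul_le_kinetic_add hs hq hd (show 0 ≤ 0.15 * C ^ 2 * s ^ 2 by positivity)
  have hC4 : C ^ 4 ≤ C ^ 2 := pow_le_pow_of_le_one hC0 hC1 (by norm_num)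
  have e1 : 2 * (0.15 * C ^ 2 * s ^ 2) ^ 2 * q / s ^ 3 = 0.045 * (C ^ 4 * (s * q)) := by
    field_simp
    ring
  have e2 : C ^ 2 / (2 * s ^ 2) * q * s ^ 3 = C ^ 2 * (s * q) / 2 := by
    field_simp
  have hsq : 0 ≤ s * q := by positivity
  have e3 : 0.3037 * C ^ 2 / R ^ 2 * q * s ^ 3 ≤ 0.15185 * (C ^ 2 * (s * q)) := by
    have : s ^ 2 / R ^ 2 ≤ 1 / 2 := by
      rw [div_le_div_iff₀ (by positivity) (by norm_num)]; linarith
    calc 0.3037 * C ^ 2 / R ^ 2 * q * s ^ 3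
        = 0.3037 * C ^ 2 * (s * q) * (s ^ 2 / R ^ 2) := by ring
      _ ≤ 0.3037 * C ^ 2 * (s * q) * (1 / 2) := by gcongr
      _ = _ := by ring
  have e4 : C ^ 4 * (s * q) ≤ C ^ 2 * (s * q) := by gcongr
  have e5 : 0 ≤ C ^ 2 * (s * q) := by positivity
  have e6 : 0.3 * C ^ 2 * s * q = 0.3 * (C ^ 2 * (s * q)) := by ring
  rw [add_mul, e2, e6]
  rw [e1] at hy
  linarith

theorem ray_outer_bound {R C s q q' d : ℝ} (hR : 0 < R) (hC0 : 0 ≤ C) (hC1 : C ≤ 1)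
    (hs : 0 < s) (hsR : s < R) (hRs : R ^ 2 ≤ 2 * s ^ 2) (hq : 0 ≤ q)
    (hd : |q'| ≤ 2 * √q * d) :
    -(0.4 * C ^ 2 / R ^ 2 * s ^ 3) * q + 0.1 * C ^ 2 / R ^ 2 * (R ^ 4 - s ^ 4) * q' +
      0.3037 * C ^ 2 / R ^ 2 * q * s ^ 3 ≤ d ^ 2 / 2 * s ^ 3 := by
  have hC4 : C ^ 4 ≤ C ^ 2 := pow_le_pow_of_le_one hC0 hC1 (by norm_num)
  have hs4 : s ^ 4 ≤ R ^ 4 := by gcongr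
  have hy := mul_le_kinetic_add hs hq hd (ψ := 0.1 * C ^ 2 / R ^ 2 * (R ^ 4 - s ^ 4))
    (mul_nonneg (by positivity) (by linarith))
  have hs6 : R ^ 6 ≤ 8 * s ^ 6 := by
    have : (R ^ 2) ^ 3 ≤ (2 * s ^ 2) ^ 3 := by gcongr
    linarith
  have hs4' : R ^ 4 - s ^ 4 ≤ 3 / 4 * R ^ 4 := by
    have : (R ^ 2) ^ 2 ≤ (2 * s ^ 2) ^ 2 := by gcongr
    linarith
  have t1 : (R ^ 4 - s ^ 4) ^ 2 ≤ 9 / 16 * R ^ 2 * (8 * s ^ 6) := by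
    calc (R ^ 4 - s ^ 4) ^ 2 ≤ (3 / 4 * R ^ 4) ^ 2 := pow_le_pow_left₀ (by linarith) hs4' 2
      _ = 9 / 16 * R ^ 2 * R ^ 6 := by ring
      _ ≤ _ := by gcongr
  have e1 : 2 * (0.1 * C ^ 2 / R ^ 2 * (R ^ 4 - s ^ 4)) ^ 2 * q / s ^ 3 ≤
      0.09 * (C ^ 2 / R ^ 2 * q * s ^ 3) := by
    rw [div_le_iff₀ (by positivity)]
    calc 2 * (0.1 * C ^ 2 / R ^ 2 * (R ^ 4 - s ^ 4)) ^ 2 * q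
        = 0.02 * (C ^ 4 / R ^ 4 * q * (R ^ 4 - s ^ 4) ^ 2) := by ring
      _ ≤ 0.02 * (C ^ 2 / R ^ 4 * q * (9 / 16 * R ^ 2 * (8 * s ^ 6))) := by gcongr
      _ = _ := by field_simp; ring
  have e2 : 0 ≤ C ^ 2 / R ^ 2 * q * s ^ 3 := by positivity
  have e3 : -(0.4 * C ^ 2 / R ^ 2 * s ^ 3) * q = -(0.4 * (C ^ 2 / R ^ 2 * q * s ^ 3)) := by ring
  have e4 : 0.3037 * C ^ 2 / R ^ 2 * q * s ^ 3 = 0.3037 * (C ^ 2 / R ^ 2 * q * s ^ 3) := by ring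
  rw [e3, e4]
  linarith

/-- Weighted one-dimensional inequality along a ray: an inverse-square potential on the inner part
of the ray, together with the kinetic energy, controls the mass on the whole ray. -/
theorem lintegral_ray_le {R C : ℝ} (hR : 0 < R) (hC0 : 0 ≤ C) (hC1 : C ≤ 1) {q q' d : ℝ → ℝ}
    (hq : ∀ s, HasDerivAt q (q' s) s) (hq'c : Continuous q') (hq0 : ∀ s, 0 ≤ q s)
    (hd : ∀ s, |q' s| ≤ 2 * √(q s) * d s) :
    ∫⁻ s in Set.Ioo 0 R, ENNReal.ofReal (0.3037 * C ^ 2 / R ^ 2 * q s * s ^ 3) ≤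
      ∫⁻ s in Set.Ioo 0 R, ENNReal.ofReal
        ((d s ^ 2 / 2 + (if 2 * s ^ 2 < R ^ 2 then C ^ 2 / (2 * s ^ 2) * q s else 0)) * s ^ 3) := by
  have hqc : Continuous q := continuous_iff_continuousAt.2 fun t => (hq t).continuousAt
  set g : ℝ := R / √2 with hgdef
  have h2 : 0 < √(2 : ℝ) := by positivity
  have hg0 : 0 < g := by positivity
  have hg2 : g ^ 2 = R ^ 2 / 2 := by rw [hgdef, div_pow, Real.sq_sqrt (by norm_num)]
  have hgR : g ≤ R := by nlinarith
  set f₁ : ℝ → ℝ := fun s => 0.3 * C ^ 2 * s * q s + 0.15 * C ^ 2 * s ^ 2 * q' s with hf₁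
  set f₂ : ℝ → ℝ := fun s => -(0.4 * C ^ 2 / R ^ 2 * s ^ 3) * q s +
    0.1 * C ^ 2 / R ^ 2 * (R ^ 4 - s ^ 4) * q' s with hf₂
  have hf₁c : Continuous f₁ := by simp only [hf₁]; fun_prop
  have hf₂c : Continuous f₂ := by simp only [hf₂]; fun_prop
  have hI₁ : ∫ s in (0 : ℝ)..g, f₁ s = 0.15 * C ^ 2 * g ^ 2 * q g := by
    rw [intervalIntegral.integral_eq_sub_of_hasDerivAt
      (f := fun s => 0.15 * C ^ 2 * s ^ 2 * q s) _ (hf₁c.intervalIntegrable _ _)]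
    · simp
    · intro s _
      refine ((((hasDerivAt_id s).pow 2).const_mul (0.15 * C ^ 2)).mul (hq s)).congr_deriv ?_
      simp only [hf₁, id, Pi.pow_apply, Nat.cast_ofNat, Nat.reduceSub]; ring
  have hI₂ : ∫ s in g..R, f₂ s = -(0.1 * C ^ 2 / R ^ 2 * (R ^ 4 - g ^ 4) * q g) := by
    rw [intervalIntegral.integral_eq_sub_of_hasDerivAt
      (f := fun s => 0.1 * C ^ 2 / R ^ 2 * (R ^ 4 - s ^ 4) * q s) _ (hf₂c.intervalIntegrable _ _)]
    · simp
    · intro s _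
      refine (((((hasDerivAt_id s).pow 4).const_sub (R ^ 4)).const_mul
        (0.1 * C ^ 2 / R ^ 2)).mul (hq s)).congr_deriv ?_
      simp only [hf₂, id, Pi.pow_apply, Nat.cast_ofNat, Nat.reduceSub]; ring
  have hsum : (∫ s in (0 : ℝ)..g, f₁ s) + ∫ s in g..R, f₂ s = 0 := by
    rw [hI₁, hI₂, show g ^ 4 = (g ^ 2) ^ 2 by ring, hg2]
    field_simp
    ring
  set k : ℝ → ℝ := fun s => 0.3037 * C ^ 2 / R ^ 2 * q s * s ^ 3 with hk
  have hkc : Continuous k := by simp only [hk]; fun_prop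
  set Φ : ℝ → ℝ := fun s => if s < g then f₁ s else f₂ s with hΦ
  have hΦ₁ : Set.EqOn Φ f₁ (Set.Ioo 0 g) := fun s hs => by simp only [hΦ, if_pos hs.2]
  have hΦ₂ : Set.EqOn Φ f₂ (Set.Ioo g R) := fun s hs => by
    simp only [hΦ, if_neg (not_lt.2 hs.1.le)]
  have hii₁ : IntervalIntegrable Φ volume 0 g := by
    refine (hf₁c.intervalIntegrable 0 g).congr_ae ?_
    rw [Set.uIoc_of_le hg0.le, ← restrict_Ioo_eq_restrict_Ioc]
    exact (ae_restrict_of_forall_mem measurableSet_Ioo fun s hs => (hΦ₁ hs).symm)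
  have hii₂ : IntervalIntegrable Φ volume g R := by
    refine (hf₂c.intervalIntegrable g R).congr_ae ?_
    rw [Set.uIoc_of_le hgR, ← restrict_Ioo_eq_restrict_Ioc]
    exact (ae_restrict_of_forall_mem measurableSet_Ioo fun s hs => (hΦ₂ hs).symm)
  have hΦint : ∫ s in (0 : ℝ)..R, Φ s = 0 := by
    rw [← intervalIntegral.integral_add_adjacent_intervals hii₁ hii₂]
    refine Eq.trans ?_ hsum
    simp only [intervalIntegral.integral_of_le hg0.le, intervalIntegral.integral_of_le hgR,
      integral_Ioc_eq_integral_Ioo]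
    rw [setIntegral_congr_fun measurableSet_Ioo hΦ₁, setIntegral_congr_fun measurableSet_Ioo hΦ₂]
  have hΦi : IntervalIntegrable Φ volume 0 R := hii₁.trans hii₂
  have hΦi' : IntegrableOn Φ (Set.Ioo 0 R) :=
    ((intervalIntegrable_iff_integrableOn_Ioc_of_le hR.le).1 hΦi).mono_set Set.Ioo_subset_Ioc_self
  have hki : IntegrableOn k (Set.Ioo 0 R) :=
    hkc.integrableOn_Ioc.mono_set Set.Ioo_subset_Ioc_self
  have hk0 : ∀ᵐ s ∂volume.restrict (Set.Ioo 0 R), 0 ≤ k s :=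
    ae_restrict_of_forall_mem measurableSet_Ioo fun s hs => by
      have := hq0 s
      have := hs.1
      simp only [hk]; positivity
  have hΦint' : ∫ s in Set.Ioo 0 R, Φ s = 0 := by
    rw [← integral_Ioc_eq_integral_Ioo, ← intervalIntegral.integral_of_le hR.le, hΦint]
  calc ∫⁻ s in Set.Ioo 0 R, ENNReal.ofReal (k s)
      = ENNReal.ofReal (∫ s in Set.Ioo 0 R, k s) :=
        (ofReal_integral_eq_lintegral_ofReal hki hk0).symm
    _ = ENNReal.ofReal (∫ s in Set.Ioo 0 R, (Φ s + k s)) := by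
        rw [integral_add hΦi' hki, hΦint', zero_add]
    _ ≤ ∫⁻ s in Set.Ioo 0 R, ENNReal.ofReal (Φ s + k s) :=
        ofReal_integral_le_lintegral_ofReal (hΦi'.add hki)
    _ ≤ _ := by
        refine setLIntegral_mono' measurableSet_Ioo fun s hs => ENNReal.ofReal_le_ofReal ?_
        have hs0 : 0 < s := hs.1
        have hsR : s < R := hs.2
        have hq0s := hq0 s
        by_cases hsg : s < g
        · have hs2 : s ^ 2 < g ^ 2 := by nlinarith
          have hcond : 2 * s ^ 2 < R ^ 2 := by rw [hg2] at hs2; linarith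
          simp only [hΦ, if_pos hsg, if_pos hcond, hf₁, hk]
          exact ray_inner_bound hR hC0 hC1 hs0 hcond.le hq0s (hd s)
        · have hs2 : g ^ 2 ≤ s ^ 2 := by nlinarith
          have hcond : ¬ 2 * s ^ 2 < R ^ 2 := by rw [hg2] at hs2; linarith
          simp only [hΦ, if_neg hsg, if_neg hcond, hf₂, hk, add_zero]
          exact ray_outer_bound hR hC0 hC1 hs0 hsR (not_lt.1 hcond) hq0s (hd s)

/-- Integration in polar coordinates on a finite-dimensional normed space. -/
theorem lintegral_polar {E : Type*} [NormedAddCommGroup E] [NormedSpace ℝ E] [FiniteDimensional ℝ E]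
    [Nontrivial E] [MeasurableSpace E] [BorelSpace E] (μ : Measure E) [μ.IsAddHaarMeasure]
    {f : E → ENNReal} (hf : Measurable f) :
    ∫⁻ x, f x ∂μ = ∫⁻ ω : Metric.sphere (0 : E) 1, (∫⁻ s in Set.Ioi (0 : ℝ),
      ENNReal.ofReal (s ^ (Module.finrank ℝ E - 1)) * f (s • (ω : E))) ∂μ.toSphere := by
  have hm : Measurable fun p : Metric.sphere (0 : E) 1 × Set.Ioi (0 : ℝ) =>
      f ((p.2 : ℝ) • (p.1 : E)) := by fun_prop
  calc ∫⁻ x, f x ∂μ = ∫⁻ x : ({(0)}ᶜ : Set E), f x ∂(μ.comap (↑)) := by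
        rw [lintegral_subtype_comap (measurableSet_singleton _).compl, restrict_compl_singleton]
    _ = ∫⁻ p, f ((p.2 : ℝ) • (p.1 : E))
          ∂μ.toSphere.prod (Measure.volumeIoiPow (Module.finrank ℝ E - 1)) := by
        rw [← (μ.measurePreserving_homeomorphUnitSphereProd).lintegral_comp hm]
        congr 1
        funext x
        have := homeomorphUnitSphereProd_symm_apply_coe E (homeomorphUnitSphereProd E x)
        rw [Homeomorph.symm_apply_apply] at this
        rw [← this]
    _ = _ := by
        rw [lintegral_prod _ hm.aemeasurable]
        congr 1
        funext ω
        rw [Measure.volumeIoiPow, lintegral_withDensity_eq_lintegral_mul _ (by fun_prop)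
          (by fun_prop)]
        exact lintegral_subtype_comap measurableSet_Ioi
          (fun s : ℝ => ENNReal.ofReal (s ^ (Module.finrank ℝ E - 1)) * f (s • (ω : E)))

/-- To compare integrals over a ball it suffices to compare them along rays. -/
theorem setLIntegral_ball_mono_of_rays {E : Type*} [NormedAddCommGroup E] [NormedSpace ℝ E]
    [FiniteDimensional ℝ E] [Nontrivial E] [MeasurableSpace E] [BorelSpace E] (μ : Measure E)
    [μ.IsAddHaarMeasure] {f g : E → ENNReal} (hf : Measurable f) (hg : Measurable g) (R : ℝ)
    (h : ∀ ω : E, ‖ω‖ = 1 →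
      ∫⁻ s in Set.Ioo 0 R, ENNReal.ofReal (s ^ (Module.finrank ℝ E - 1)) * f (s • ω) ≤
        ∫⁻ s in Set.Ioo 0 R, ENNReal.ofReal (s ^ (Module.finrank ℝ E - 1)) * g (s • ω)) :
    ∫⁻ x in Metric.ball 0 R, f x ∂μ ≤ ∫⁻ x in Metric.ball 0 R, g x ∂μ := by
  have key : ∀ k : E → ENNReal, Measurable k → ∫⁻ x in Metric.ball 0 R, k x ∂μ =
      ∫⁻ ω : Metric.sphere (0 : E) 1, (∫⁻ s in Set.Ioo 0 R,
        ENNReal.ofReal (s ^ (Module.finrank ℝ E - 1)) * k (s • (ω : E))) ∂μ.toSphere := by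
    intro k hk
    rw [← lintegral_indicator measurableSet_ball,
      lintegral_polar μ (hk.indicator measurableSet_ball)]
    congr 1
    funext ω
    have hω : ‖(ω : E)‖ = 1 := by simp
    rw [← Set.Ioi_inter_Iio, Set.inter_comm, ← Measure.restrict_restrict measurableSet_Iio,
      ← lintegral_indicator measurableSet_Iio]
    refine setLIntegral_congr_fun measurableSet_Ioi fun s hs => ?_
    have hs' : 0 < s := hs
    have hn : ‖s • (ω : E)‖ = s := by rw [norm_smul, hω, mul_one, Real.norm_of_nonneg hs'.le]
    by_cases hsR : s < R
    · rw [Set.indicator_of_mem (by simpa [hn] using hsR), Set.indicator_of_mem (by exact hsR)]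
    · rw [Set.indicator_of_notMem (by simpa [hn] using hsR), Set.indicator_of_notMem (by exact hsR),
        mul_zero]
  rw [key f hf, key g hg]
  exact lintegral_mono fun ω => h ω (by simp)

/-- Bessel's inequality for two orthogonal vectors in four dimensions. -/
theorem bessel_real (a b c d x y z w x' y' z' w' : ℝ)
    (h : x * x' + y * y' + z * z' + w * w' = 0) :
    (a * x + b * y + c * z + d * w) ^ 2 / (x ^ 2 + y ^ 2 + z ^ 2 + w ^ 2) +
      (a * x' + b * y' + c * z' + d * w') ^ 2 / (x' ^ 2 + y' ^ 2 + z' ^ 2 + w' ^ 2) ≤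
      a ^ 2 + b ^ 2 + c ^ 2 + d ^ 2 := by
  set m := a * x + b * y + c * z + d * w with hm
  set m' := a * x' + b * y' + c * z' + d * w' with hm'
  set P := x ^ 2 + y ^ 2 + z ^ 2 + w ^ 2 with hP
  set P' := x' ^ 2 + y' ^ 2 + z' ^ 2 + w' ^ 2 with hP'
  have e : m ^ 2 / P = 2 * (m / P) * m - (m / P) ^ 2 * P := by
    by_cases h0 : P = 0
    · simp [h0]
    · field_simp; ring
  have e' : m' ^ 2 / P' = 2 * (m' / P') * m' - (m' / P') ^ 2 * P' := by
    by_cases h0 : P' = 0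
    · simp [h0]
    · field_simp; ring
  rw [e, e']
  generalize m / P = s
  generalize m' / P' = t
  rw [hm, hm', hP, hP']
  have : 0 ≤ (a - s * x - t * x') ^ 2 + (b - s * y - t * y') ^ 2 + (c - s * z - t * z') ^ 2 +
    (d - s * w - t * w') ^ 2 := by positivity
  linear_combination this + 2 * s * t * h

/-- Total squared covariant gradient of a function of two points of the plane. -/
def pairKinetic (A B : ℂ × ℂ → ℂ) (F : ℂ × ℂ → ℂ) (p : ℂ × ℂ) : ℝ :=
  (‖pairCovDeriv A B F p (1, 0)‖ ^ 2 + ‖pairCovDeriv A B F p (Complex.I, 0)‖ ^ 2) +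
    (‖pairCovDeriv A B F p (0, 1)‖ ^ 2 + ‖pairCovDeriv A B F p (0, Complex.I)‖ ^ 2)

theorem pairCovDeriv_eq_sum (A B F : ℂ × ℂ → ℂ) (p v : ℂ × ℂ) :
    pairCovDeriv A B F p v = pairCovDeriv A B F p (1, 0) * v.1.re +
      pairCovDeriv A B F p (Complex.I, 0) * v.1.im + pairCovDeriv A B F p (0, 1) * v.2.re +
      pairCovDeriv A B F p (0, Complex.I) * v.2.im := by
  have hv : v = v.1.re • ((1 : ℂ), (0 : ℂ)) + v.1.im • (Complex.I, (0 : ℂ)) +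
      v.2.re • ((0 : ℂ), (1 : ℂ)) + v.2.im • ((0 : ℂ), Complex.I) := by
    ext <;> simp
  have hL : fderiv ℝ F p v = v.1.re * fderiv ℝ F p (1, 0) + v.1.im * fderiv ℝ F p (Complex.I, 0) +
      v.2.re * fderiv ℝ F p (0, 1) + v.2.im * fderiv ℝ F p (0, Complex.I) := by
    conv_lhs => rw [hv]
    simp only [map_add, map_smul, Complex.real_smul]
  rw [pairCovDeriv, hL]
  simp only [pairCovDeriv, Complex.mul_re, Complex.conj_re, Complex.conj_im, Complex.one_re,
    Complex.one_im, Complex.I_re, Complex.I_im, Complex.zero_re, Complex.zero_im]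
  push_cast
  ring

theorem pairCovDeriv_smul (A B F : ℂ × ℂ → ℂ) (p v : ℂ × ℂ) (s : ℝ) :
    pairCovDeriv A B F p (s • v) = s * pairCovDeriv A B F p v := by
  rw [pairCovDeriv_eq_sum, pairCovDeriv_eq_sum _ _ _ _ v]
  simp
  ring

/-- The radial direction and the direction of rotation about the midpoint are orthogonal. -/
theorem radial_add_angular_le_pairKinetic (A B F : ℂ × ℂ → ℂ) (p : ℂ × ℂ) :
    ‖pairCovDeriv A B F p p‖ ^ 2 / (2 * ‖p‖ ^ 2) +
      1 / (2 * ‖(p.1 - p.2) / 2‖ ^ 2) * ‖pairCovDeriv A B F p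
        (Complex.I * ((p.1 - p.2) / 2), -(Complex.I * ((p.1 - p.2) / 2)))‖ ^ 2 ≤
      pairKinetic A B F p := by
  have norm_sq_eq : ∀ ζ : ℂ, ‖ζ‖ ^ 2 = ζ.re ^ 2 + ζ.im ^ 2 := fun ζ => by
    rw [← Complex.normSq_eq_norm_sq, Complex.normSq_apply]; ring
  set Q : ℝ := p.1.re ^ 2 + p.1.im ^ 2 + p.2.re ^ 2 + p.2.im ^ 2 with hQ
  set η : ℂ := Complex.I * ((p.1 - p.2) / 2) with hη
  have hre : η.re = -((p.1.im - p.2.im) / 2) := by simp [hη]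
  have him : η.im = (p.1.re - p.2.re) / 2 := by simp [hη]
  have hηn : 2 * ‖(p.1 - p.2) / 2‖ ^ 2 =
      η.re ^ 2 + η.im ^ 2 + (-η).re ^ 2 + (-η).im ^ 2 := by
    have : ‖(p.1 - p.2) / 2‖ = ‖η‖ := by simp [hη]
    rw [this, norm_sq_eq, Complex.neg_re, Complex.neg_im]; ring
  have hQp : Q ≤ 2 * ‖p‖ ^ 2 := by
    have h1 := pow_le_pow_left₀ (norm_nonneg _) (norm_fst_le p) 2
    have h2 := pow_le_pow_left₀ (norm_nonneg _) (norm_snd_le p) 2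
    rw [norm_sq_eq] at h1 h2
    linarith
  have hQp0 : p ≠ 0 → 0 < Q := by
    intro hp
    have h0 : 0 ≤ Q := by positivity
    refine lt_of_le_of_ne h0 fun h => hp ?_
    have : p.1.re ^ 2 = 0 ∧ p.1.im ^ 2 = 0 ∧ p.2.re ^ 2 = 0 ∧ p.2.im ^ 2 = 0 := by
      refine ⟨?_, ?_, ?_, ?_⟩ <;> nlinarith [sq_nonneg p.1.re, sq_nonneg p.1.im,
        sq_nonneg p.2.re, sq_nonneg p.2.im]
    simp only [pow_eq_zero_iff two_ne_zero] at this
    exact Prod.ext (Complex.ext this.1 this.2.1) (Complex.ext this.2.2.1 this.2.2.2)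
  have hrad : ‖pairCovDeriv A B F p p‖ ^ 2 / (2 * ‖p‖ ^ 2) ≤ ‖pairCovDeriv A B F p p‖ ^ 2 / Q := by
    by_cases hp : p = 0
    · have : Q = 0 := by simp [hQ, hp]
      simp [hp, this]
    · exact div_le_div_of_nonneg_left (by positivity) (hQp0 hp) hQp
  refine (add_le_add_left hrad _).trans ?_
  rw [pairCovDeriv_eq_sum A B F p p, pairCovDeriv_eq_sum A B F p (η, -η), pairKinetic, hηn]
  generalize pairCovDeriv A B F p (1, 0) = a
  generalize pairCovDeriv A B F p (Complex.I, 0) = b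
  generalize pairCovDeriv A B F p (0, 1) = c
  generalize pairCovDeriv A B F p (0, Complex.I) = d
  have hort : p.1.re * η.re + p.1.im * η.im + p.2.re * (-η).re + p.2.im * (-η).im = 0 := by
    rw [Complex.neg_re, Complex.neg_im, hre, him]; ring
  have h1 := bessel_real a.re b.re c.re d.re _ _ _ _ _ _ _ _ hort
  have h2 := bessel_real a.im b.im c.im d.im _ _ _ _ _ _ _ _ hort
  simp only [norm_sq_eq, Complex.add_re, Complex.add_im, Complex.re_mul_ofReal,
    Complex.im_mul_ofReal]
  rw [add_div, one_div_mul_eq_div, add_div]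
  linarith

/-- Diamagnetic inequality along a ray. -/
theorem abs_deriv_norm_sq_le (A B : ℂ × ℂ → ℂ) (F : ℂ × ℂ → ℂ) (p v : ℂ × ℂ) :
    |2 * (starRingEnd ℂ (F p) * fderiv ℝ F p v).re| ≤
      2 * √(‖F p‖ ^ 2) * ‖pairCovDeriv A B F p v‖ := by
  have e : (starRingEnd ℂ (F p) * fderiv ℝ F p v).re =
      (starRingEnd ℂ (F p) * (Complex.I * pairCovDeriv A B F p v)).re := by
    simp only [pairCovDeriv, Complex.mul_re, Complex.mul_im, Complex.conj_re, Complex.conj_im,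
      Complex.add_re, Complex.add_im, Complex.I_re, Complex.I_im, Complex.neg_re, Complex.neg_im,
      Complex.ofReal_re, Complex.ofReal_im]
    ring
  rw [Real.sqrt_sq (norm_nonneg _), e, abs_mul, abs_two, mul_assoc]
  refine mul_le_mul_of_nonneg_left ?_ zero_le_two
  refine (Complex.abs_re_le_norm _).trans ?_
  simp

theorem lintegral_ray_pairCovDeriv_le {R C : ℝ} (hR : 0 < R) (hC0 : 0 ≤ C) (hC1 : C ≤ 1)
    (A B : ℂ × ℂ → ℂ) {F : ℂ × ℂ → ℂ} (hF : ContDiff ℝ 1 F) {ω : ℂ × ℂ} (hω : ‖ω‖ = 1) :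
    ∫⁻ s in Set.Ioo 0 R, ENNReal.ofReal (s ^ 3) *
        ENNReal.ofReal (0.3037 * C ^ 2 / R ^ 2 * ‖F (s • ω)‖ ^ 2) ≤
      ∫⁻ s in Set.Ioo 0 R, ENNReal.ofReal (s ^ 3) * ENNReal.ofReal
        (‖pairCovDeriv A B F (s • ω) (s • ω)‖ ^ 2 / (2 * ‖s • ω‖ ^ 2) +
          if 2 * ‖s • ω‖ ^ 2 < R ^ 2 then C ^ 2 / (2 * ‖s • ω‖ ^ 2) * ‖F (s • ω)‖ ^ 2 else 0) := by
  have hder : ∀ s : ℝ, HasDerivAt (fun s : ℝ => ‖F (s • ω)‖ ^ 2)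
      (2 * (starRingEnd ℂ (F (s • ω)) * fderiv ℝ F (s • ω) ω).re) s := by
    intro s
    have h1 : HasDerivAt (fun s : ℝ => s • ω) ω s := by
      simpa using (hasDerivAt_id s).smul_const ω
    have h2 : HasDerivAt (fun s : ℝ => F (s • ω)) (fderiv ℝ F (s • ω) ω) s :=
      ((hF.differentiable one_ne_zero) (s • ω)).hasFDerivAt.comp_hasDerivAt s h1
    refine h2.norm_sq.congr_deriv ?_
    rw [Complex.inner, mul_comm (starRingEnd ℂ _)]
  have hcont : Continuous fun s : ℝ =>
      2 * (starRingEnd ℂ (F (s • ω)) * fderiv ℝ F (s • ω) ω).re := by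
    have hline : Continuous fun s : ℝ => s • ω := by fun_prop
    have h1 : Continuous fun s : ℝ => fderiv ℝ F (s • ω) ω :=
      ((hF.continuous_fderiv one_ne_zero).comp hline).clm_apply continuous_const
    have h2 : Continuous fun s : ℝ => starRingEnd ℂ (F (s • ω)) :=
      Complex.continuous_conj.comp (hF.continuous.comp hline)
    exact continuous_const.mul (Complex.continuous_re.comp (h2.mul h1))
  have key := lintegral_ray_le hR hC0 hC1 hder hcont (fun s => by positivity)
    (fun s => abs_deriv_norm_sq_le A B F (s • ω) ω)
  refine (Eq.le ?_).trans (key.trans (Eq.le ?_))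
  · refine setLIntegral_congr_fun measurableSet_Ioo fun s hs => ?_
    have hs0 : 0 ≤ s := hs.1.le
    rw [← ENNReal.ofReal_mul (by positivity), mul_comm (s ^ 3)]
  · refine setLIntegral_congr_fun measurableSet_Ioo fun s hs => ?_
    have hs0 : 0 < s := hs.1
    have hn : ‖s • ω‖ = s := by rw [norm_smul, hω, mul_one, Real.norm_of_nonneg hs0.le]
    rw [← ENNReal.ofReal_mul (by positivity), mul_comm (s ^ 3), hn, pairCovDeriv_smul, norm_mul,
      Complex.norm_real, Real.norm_of_nonneg hs0.le]
    congr 3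
    field_simp

theorem ae_fst_ne_snd : ∀ᵐ p : ℂ × ℂ, p.1 ≠ p.2 := by
  have hm : MeasurableSet {p : ℂ × ℂ | p.1 ≠ p.2} :=
    (measurableSet_eq_fun measurable_fst measurable_snd).compl
  rw [Measure.volume_eq_prod, Measure.ae_prod_iff_ae_ae hm]
  refine Filter.Eventually.of_forall fun x => ?_
  have : ∀ᵐ y : ℂ, y ≠ x := by
    simpa using measure_eq_zero_iff_ae_notMem.1 (measure_singleton (μ := (volume : Measure ℂ)) x)
  filter_upwards [this] with y hy using Ne.symm hy

theorem exchangeWeight_eq_zero {R : ℝ} {p : ℂ × ℂ} (hp : p ∉ Metric.ball (0 : ℂ × ℂ) R) :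
    exchangeWeight R p = 0 := by
  refine if_neg fun h => hp ?_
  rw [mem_ball_zero_iff, Prod.norm_def, max_lt_iff]
  have e1 : p.1 = (p.1 + p.2) / 2 + (p.1 - p.2) / 2 := by ring
  have e2 : p.2 = (p.1 + p.2) / 2 - (p.1 - p.2) / 2 := by ring
  constructor
  · exact (congrArg norm e1).trans_le (norm_add_le _ _) |>.trans_lt h
  · exact (congrArg norm e2).trans_le (norm_sub_le _ _) |>.trans_lt h

theorem ofReal_le_exchangeWeight {R : ℝ} (hR : 0 < R) {p : ℂ × ℂ} (hp : p.1 ≠ p.2)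
    (h : 2 * ‖p‖ ^ 2 < R ^ 2) :
    ENNReal.ofReal (1 / (2 * ‖p‖ ^ 2)) ≤ exchangeWeight R p := by
  set X := (p.1 + p.2) / 2 with hX
  set w := (p.1 - p.2) / 2 with hw
  have hpar : ‖X‖ ^ 2 + ‖w‖ ^ 2 = (‖p.1‖ ^ 2 + ‖p.2‖ ^ 2) / 2 := by
    have := parallelogram_law_with_norm ℝ p.1 p.2
    rw [hX, hw, norm_div, norm_div, Complex.norm_two]
    linear_combination this / 4
  have h1 := pow_le_pow_left₀ (norm_nonneg _) (norm_fst_le p) 2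
  have h2 := pow_le_pow_left₀ (norm_nonneg _) (norm_snd_le p) 2
  have hw0 : 0 < ‖w‖ := by
    rw [norm_pos_iff, hw]
    exact div_ne_zero (sub_ne_zero.2 hp) two_ne_zero
  have hlt : ‖X‖ + ‖w‖ < R := by
    refine lt_of_pow_lt_pow_left₀ 2 hR.le ?_
    nlinarith [sq_nonneg (‖X‖ - ‖w‖)]
  rw [exchangeWeight, if_pos hlt]
  refine ENNReal.ofReal_le_ofReal (one_div_le_one_div_of_le (by positivity) ?_)
  nlinarith [sq_nonneg ‖X‖]

/-- Exclusion principle for a pair of anyons in the presence of further particles. -/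
theorem lintegral_pairKinetic_ge {α C R : ℝ} {ι : Type*} (S : Finset ι) (z : ι → ℂ)
    {F : ℂ × ℂ → ℂ} (hF : ContDiff ℝ 1 F) (hsymm : ∀ p : ℂ × ℂ, F p.swap = F p) (hR : 0 < R)
    (hC0 : 0 ≤ C) (hC1 : C ≤ 1)
    (hC : ∀ m ≤ S.card, ∀ q : ℤ, C ≤ |(2 * (m : ℝ) + 1) * α - 2 * q|) :
    ∫⁻ p in Metric.ball 0 R, ENNReal.ofReal (0.3037 * C ^ 2 / R ^ 2 * ‖F p‖ ^ 2) ≤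
      ∫⁻ p in Metric.ball 0 R, ENNReal.ofReal
        (pairKinetic (anyonPot α S z) (fun p => anyonPot α S z p.swap) F p) := by
  set A := anyonPot α S z
  set B : ℂ × ℂ → ℂ := fun p => anyonPot α S z p.swap
  have hA : Measurable A := measurable_anyonPot α S z
  have hB : Measurable B := hA.comp measurable_swap
  have hFm : Measurable F := hF.continuous.measurable
  have hW := measurable_exchangeWeight R
  set rad : ℂ × ℂ → ℝ := fun p => ‖pairCovDeriv A B F p p‖ ^ 2 / (2 * ‖p‖ ^ 2) with hrad
  set pot : ℂ × ℂ → ℝ := fun p =>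
    if 2 * ‖p‖ ^ 2 < R ^ 2 then C ^ 2 / (2 * ‖p‖ ^ 2) * ‖F p‖ ^ 2 else 0 with hpot
  set ang : ℂ × ℂ → ℝ := fun p => ‖pairCovDeriv A B F p
    (Complex.I * ((p.1 - p.2) / 2), -(Complex.I * ((p.1 - p.2) / 2)))‖ ^ 2 with hang
  have hradm : Measurable rad := by
    have := measurable_pairCovDeriv hA hB hF (V := fun p => p) continuous_id
    simp only [hrad]
    fun_prop
  have hpotm : Measurable pot :=
    Measurable.ite (measurableSet_lt (by fun_prop) measurable_const) (by fun_prop) measurable_const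
  have hrad0 : ∀ p, 0 ≤ rad p := fun p => by simp only [hrad]; positivity
  have hpot0 : ∀ p, 0 ≤ pot p := fun p => by simp only [hpot]; split_ifs <;> positivity
  have : (volume : Measure (ℂ × ℂ)).IsAddHaarMeasure := by
    rw [Measure.volume_eq_prod]; infer_instance
  have hdim : Module.finrank ℝ (ℂ × ℂ) - 1 = 3 := by simp
  calc ∫⁻ p in Metric.ball 0 R, ENNReal.ofReal (0.3037 * C ^ 2 / R ^ 2 * ‖F p‖ ^ 2)
      ≤ ∫⁻ p in Metric.ball 0 R, ENNReal.ofReal (rad p + pot p) := by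
        refine setLIntegral_ball_mono_of_rays volume (by fun_prop) (by fun_prop) R fun ω hω => ?_
        rw [hdim]
        exact lintegral_ray_pairCovDeriv_le hR hC0 hC1 A B hF hω
    _ = (∫⁻ p in Metric.ball 0 R, ENNReal.ofReal (rad p)) +
          ∫⁻ p in Metric.ball 0 R, ENNReal.ofReal (pot p) := by
        rw [← lintegral_add_left (by fun_prop)]
        simp only [ENNReal.ofReal_add (hrad0 _) (hpot0 _)]
    _ ≤ (∫⁻ p in Metric.ball 0 R, ENNReal.ofReal (rad p)) +
          ∫⁻ p, exchangeWeight R p * ENNReal.ofReal (C ^ 2 * ‖F p‖ ^ 2) := by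
        refine add_le_add le_rfl ?_
        refine (setLIntegral_le_lintegral _ _).trans (lintegral_mono_ae ?_)
        filter_upwards [ae_fst_ne_snd] with p hp
        simp only [hpot]
        split_ifs with h
        · calc ENNReal.ofReal (C ^ 2 / (2 * ‖p‖ ^ 2) * ‖F p‖ ^ 2)
              = ENNReal.ofReal (1 / (2 * ‖p‖ ^ 2)) * ENNReal.ofReal (C ^ 2 * ‖F p‖ ^ 2) := by
                rw [← ENNReal.ofReal_mul (by positivity)]
                congr 1
                ring
            _ ≤ _ := by gcongr; exact ofReal_le_exchangeWeight hR hp h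
        · simp
    _ ≤ (∫⁻ p in Metric.ball 0 R, ENNReal.ofReal (rad p)) +
          ∫⁻ p, exchangeWeight R p * ENNReal.ofReal (ang p) := by
        exact add_le_add le_rfl (lintegral_exchange_hardy S z hF hsymm hC0 hC R)
    _ = (∫⁻ p in Metric.ball 0 R, ENNReal.ofReal (rad p)) +
          ∫⁻ p in Metric.ball 0 R, exchangeWeight R p * ENNReal.ofReal (ang p) := by
        congr 1
        rw [← lintegral_indicator measurableSet_ball]
        congr 1
        funext p
        by_cases hp : p ∈ Metric.ball (0 : ℂ × ℂ) R
        · rw [Set.indicator_of_mem hp]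
        · rw [Set.indicator_of_notMem hp, exchangeWeight_eq_zero hp, zero_mul]
    _ = ∫⁻ p in Metric.ball 0 R, (ENNReal.ofReal (rad p) +
          exchangeWeight R p * ENNReal.ofReal (ang p)) :=
        (lintegral_add_left (by fun_prop) _).symm
    _ ≤ _ := by
        refine lintegral_mono fun p => ?_
        refine le_trans ?_ (ENNReal.ofReal_le_ofReal (radial_add_angular_le_pairKinetic A B F p))
        rw [ENNReal.ofReal_add (hrad0 p) (by positivity)]
        refine add_le_add le_rfl ?_
        rw [ENNReal.ofReal_mul (by positivity)]
        gcongr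
        rw [exchangeWeight]
        split_ifs
        · exact le_rfl
        · exact zero_le

theorem statC_nonneg (α : ℝ) (N : ℕ) : 0 ≤ statC α N :=
  Real.iInf_nonneg fun _ => Real.iInf_nonneg fun _ => abs_nonneg _

theorem statC_le (α : ℝ) {N m : ℕ} (hm : m < N - 1) (q : ℤ) :
    statC α N ≤ |(2 * (m : ℝ) + 1) * α - 2 * q| := by
  refine (ciInf_le ⟨0, ?_⟩ (⟨m, hm⟩ : Fin (N - 1))).trans (ciInf_le ⟨0, ?_⟩ q)
  · rintro _ ⟨p, rfl⟩
    exact Real.iInf_nonneg fun _ => abs_nonneg _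
  · rintro _ ⟨p, rfl⟩
    exact abs_nonneg _

theorem statC_le_one (α : ℝ) {N : ℕ} (hN : 2 ≤ N) : statC α N ≤ 1 := by
  refine (statC_le α (m := 0) (by omega) (round (α / 2))).trans ?_
  have h := abs_sub_round (α / 2)
  have e : (2 * ((0 : ℕ) : ℝ) + 1) * α - 2 * (round (α / 2) : ℝ) =
      2 * (α / 2 - round (α / 2)) := by push_cast; ring
  rw [e, abs_mul, abs_two]
  linarith

theorem setLIntegral_ball_add_right (c : ℂ) (r : ℝ) (g : ℂ → ENNReal) :
    ∫⁻ a in Metric.ball c r, g a = ∫⁻ a in Metric.ball 0 r, g (a + c) := by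
  rw [← lintegral_indicator measurableSet_ball, ← lintegral_indicator measurableSet_ball,
    ← lintegral_add_right_eq_self _ c]
  congr 1
  funext a
  simp [Set.indicator, dist_eq_norm]

section Pair

variable {N : ℕ} {α : ℝ} {u : (Fin N → ℂ) → ℂ}

theorem measurable_covSq (α : ℝ) (hu : ContDiff ℝ 1 u) (j : Fin N) : Measurable (covSq α u j) := by
  have hd : ∀ v : Fin N → ℂ, Measurable fun x => fderiv ℝ u x v := fun v =>
    ((hu.continuous_fderiv one_ne_zero).clm_apply continuous_const).measurable
  have h1 := hd (Pi.single j 1)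
  have h2 := hd (Pi.single j Complex.I)
  have h3 : Measurable u := hu.continuous.measurable
  have h4 : Measurable fun x : Fin N → ℂ => (α : ℂ) * ∑ k ∈ Finset.univ.erase j,
      Complex.I * (x j - x k) / ((‖x j - x k‖ : ℂ) ^ 2) :=
    (Finset.measurable_fun_sum _ fun l _ => by fun_prop).const_mul _
  unfold covSq
  fun_prop

theorem covSq_nonneg (α : ℝ) (u : (Fin N → ℂ) → ℂ) (j : Fin N) (x : Fin N → ℂ) :
    0 ≤ covSq α u j x := by
  unfold covSq
  positivity

/-- The configuration `x` with the particles `j` and `k` moved to `p.1 + c` and `p.2 + c`. -/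
def withPair (x : Fin N → ℂ) (j k : Fin N) (c : ℂ) (p : ℂ × ℂ) : Fin N → ℂ :=
  Function.update (Function.update x j (p.1 + c)) k (p.2 + c)

theorem withPair_fst (x : Fin N → ℂ) {j k : Fin N} (hjk : j ≠ k) (c : ℂ) (p : ℂ × ℂ) :
    withPair x j k c p j = p.1 + c := by
  simp [withPair, hjk]

theorem withPair_snd (x : Fin N → ℂ) (j k : Fin N) (c : ℂ) (p : ℂ × ℂ) :
    withPair x j k c p k = p.2 + c := by
  simp [withPair]

theorem withPair_of_ne (x : Fin N → ℂ) {j k l : Fin N} (hj : l ≠ j) (hk : l ≠ k) (c : ℂ)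
    (p : ℂ × ℂ) : withPair x j k c p l = x l := by
  simp [withPair, hj, hk]

theorem withPair_swap (x : Fin N → ℂ) {j k : Fin N} (hjk : j ≠ k) (c : ℂ) (p : ℂ × ℂ) :
    withPair x j k c p.swap = withPair x j k c p ∘ Equiv.swap j k := by
  funext l
  rw [Function.comp_apply]
  by_cases hj : l = j
  · rw [hj, Equiv.swap_apply_left, withPair_fst x hjk, withPair_snd, Prod.fst_swap]
  by_cases hk : l = k
  · rw [hk, Equiv.swap_apply_right, withPair_fst x hjk, withPair_snd, Prod.snd_swap]
  rw [Equiv.swap_apply_of_ne_of_ne hj hk, withPair_of_ne x hj hk, withPair_of_ne x hj hk]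

theorem withPair_eq_add (x : Fin N → ℂ) {j k : Fin N} (hjk : j ≠ k) (c : ℂ) (p : ℂ × ℂ) :
    withPair x j k c p = withPair x j k c 0 +
      (ContinuousLinearMap.single ℝ (fun _ : Fin N => ℂ) j p.1 +
        ContinuousLinearMap.single ℝ (fun _ : Fin N => ℂ) k p.2) := by
  funext l
  by_cases hj : l = j
  · subst hj
    simp [withPair_fst x hjk, hjk, add_comm]
  by_cases hk : l = k
  · subst hk
    simp [withPair_snd, hj, add_comm]
  simp [withPair_of_ne x hj hk, hj, hk]

theorem hasFDerivAt_withPair (x : Fin N → ℂ) {j k : Fin N} (hjk : j ≠ k) (c : ℂ) (p : ℂ × ℂ) :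
    HasFDerivAt (withPair x j k c)
      ((ContinuousLinearMap.single ℝ (fun _ : Fin N => ℂ) j).comp (ContinuousLinearMap.fst ℝ ℂ ℂ) +
        (ContinuousLinearMap.single ℝ (fun _ : Fin N => ℂ) k).comp (ContinuousLinearMap.snd ℝ ℂ ℂ))
      p := by
  rw [show withPair x j k c = fun p => _ from funext (withPair_eq_add x hjk c)]
  set L := (ContinuousLinearMap.single ℝ (fun _ : Fin N => ℂ) j).comp
      (ContinuousLinearMap.fst ℝ ℂ ℂ) +
    (ContinuousLinearMap.single ℝ (fun _ : Fin N => ℂ) k).comp (ContinuousLinearMap.snd ℝ ℂ ℂ)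
  exact (L.hasFDerivAt (x := p)).const_add _

theorem contDiff_withPair (x : Fin N → ℂ) {j k : Fin N} (hjk : j ≠ k) (c : ℂ) :
    ContDiff ℝ 1 (withPair x j k c) := by
  rw [show withPair x j k c = fun p => _ from funext (withPair_eq_add x hjk c)]
  fun_prop

theorem fderiv_comp_withPair (hu : ContDiff ℝ 1 u) (x : Fin N → ℂ) {j k : Fin N} (hjk : j ≠ k)
    (c : ℂ) (p v : ℂ × ℂ) :
    fderiv ℝ (fun p => u (withPair x j k c p)) p v =
      fderiv ℝ u (withPair x j k c p) (Pi.single j v.1 + Pi.single k v.2) := by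
  have h := ((hu.differentiable one_ne_zero) (withPair x j k c p)).hasFDerivAt.comp p
    (hasFDerivAt_withPair x hjk c p)
  rw [show (fun p => u (withPair x j k c p)) = u ∘ withPair x j k c from rfl, h.fderiv]
  simp

theorem sum_erase_eq_anyonPot (α : ℝ) (y : Fin N → ℂ) {j k : Fin N} (hjk : j ≠ k) (c : ℂ) :
    (α : ℂ) * ∑ l ∈ Finset.univ.erase j, Complex.I * (y j - y l) / ((‖y j - y l‖ : ℂ) ^ 2) =
      anyonPot α ((Finset.univ.erase j).erase k) (fun l => y l - c) (y j - c, y k - c) := by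
  rw [← Finset.add_sum_erase _ _ (Finset.mem_erase.2 ⟨hjk.symm, Finset.mem_univ k⟩)]
  simp [anyonPot]

theorem anyonPot_congr {ι : Type*} (α : ℝ) {S : Finset ι} {z z' : ι → ℂ}
    (h : ∀ l ∈ S, z l = z' l) (p : ℂ × ℂ) : anyonPot α S z p = anyonPot α S z' p := by
  simp only [anyonPot]
  rw [Finset.sum_congr rfl fun l hl => by rw [h l hl]]

theorem covSq_add_covSq_eq_pairKinetic (hu : ContDiff ℝ 1 u) (x : Fin N → ℂ) {j k : Fin N}
    (hjk : j ≠ k) (c : ℂ) (p : ℂ × ℂ) :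
    covSq α u j (withPair x j k c p) + covSq α u k (withPair x j k c p) =
      pairKinetic (anyonPot α ((Finset.univ.erase j).erase k) fun l => x l - c)
        (fun p => anyonPot α ((Finset.univ.erase j).erase k) (fun l => x l - c) p.swap)
        (fun p => u (withPair x j k c p)) p := by
  set S := (Finset.univ.erase j).erase k with hS
  have hz : ∀ l ∈ S, withPair x j k c p l - c = x l - c := by
    intro l hl
    rw [hS, Finset.mem_erase, Finset.mem_erase] at hl
    rw [withPair_of_ne x hl.2.1 hl.1]
  have hj := sum_erase_eq_anyonPot α (withPair x j k c p) hjk c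
  have hk := sum_erase_eq_anyonPot α (withPair x j k c p) hjk.symm c
  rw [Finset.erase_right_comm] at hk
  rw [← hS, anyonPot_congr α hz, withPair_fst x hjk, withPair_snd] at hj hk
  simp only [add_sub_cancel_right] at hj hk
  simp only [covSq, pairKinetic, pairCovDeriv, withPair_fst x hjk, withPair_snd]
  rw [hj, hk]
  simp [fderiv_comp_withPair hu x hjk, Prod.swap]

/-- Integration over the positions of two of the particles. -/
theorem lmarginal_pair (c : ℂ) (r : ℝ) {j k : Fin N} (hjk : j ≠ k) {f : (Fin N → ℂ) → ENNReal}
    (hf : Measurable f) (x : Fin N → ℂ) :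
    (∫⋯∫⁻_{j, k}, f ∂fun _ => volume.restrict (Metric.ball c r)) x =
      ∫⁻ p in Metric.ball (0 : ℂ × ℂ) r, f (withPair x j k c p) := by
  have hm : Measurable fun p => f (withPair x j k c p) :=
    hf.comp (contDiff_withPair x hjk c).continuous.measurable
  rw [lmarginal_insert _ hf (by simpa using hjk), lmarginal_singleton,
    show (0 : ℂ × ℂ) = (0, 0) from rfl, ← ball_prod_same, Measure.volume_eq_prod,
    ← Measure.prod_restrict, lintegral_prod _ hm.aemeasurable, setLIntegral_ball_add_right]
  simp only [setLIntegral_ball_add_right c, withPair]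

theorem lintegral_covSq_pair_ge (hN : 2 ≤ N) (c : ℂ) {r : ℝ} (hr : 0 < r)
    (hu : ContDiff ℝ 1 u) (hsymm : ∀ (σ : Equiv.Perm (Fin N)) (x : Fin N → ℂ), u (x ∘ σ) = u x)
    {j k : Fin N} (hjk : j ≠ k) :
    ENNReal.ofReal (0.3037 * statC α N ^ 2 / r ^ 2) *
        ∫⁻ x in Set.univ.pi (fun _ : Fin N => Metric.ball c r), ENNReal.ofReal (‖u x‖ ^ 2) ≤
      (∫⁻ x in Set.univ.pi (fun _ : Fin N => Metric.ball c r), ENNReal.ofReal (covSq α u j x)) +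
        ∫⁻ x in Set.univ.pi (fun _ : Fin N => Metric.ball c r), ENNReal.ofReal (covSq α u k x) := by
  have hum : Measurable u := hu.continuous.measurable
  have hj := measurable_covSq α hu j
  have hk := measurable_covSq α hu k
  rw [← lintegral_add_left (by fun_prop), ← lintegral_const_mul' _ _ ENNReal.ofReal_ne_top,
    volume_pi, Measure.restrict_pi_pi]
  refine lintegral_le_of_lmarginal_le {j, k} (by fun_prop) (by fun_prop) fun x => ?_
  rw [lmarginal_pair c r hjk (by fun_prop), lmarginal_pair c r hjk (by fun_prop)]
  simp only [← ENNReal.ofReal_add (covSq_nonneg _ _ _ _) (covSq_nonneg _ _ _ _),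
    covSq_add_covSq_eq_pairKinetic hu x hjk,
    ← ENNReal.ofReal_mul (show 0 ≤ 0.3037 * statC α N ^ 2 / r ^ 2 by positivity)]
  refine lintegral_pairKinetic_ge _ _ (hu.comp (contDiff_withPair x hjk c)) (fun p => ?_) hr
    (statC_nonneg α N) (statC_le_one α hN) fun m hm q => statC_le α ?_ q
  · rw [withPair_swap x hjk, hsymm]
  · rw [Finset.card_erase_of_mem (by simp [hjk.symm]), Finset.card_erase_of_mem (by simp),
      Finset.card_univ, Fintype.card_fin] at hm
    omega

end Pair

/-- Adding up a two-body bound around a cycle through all the particles. -/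
theorem lintegral_sum_ge_of_pair {n : ℕ} (hn : 2 ≤ n) {X : Type*} [MeasurableSpace X]
    {μ : Measure X} {e : Fin n → X → ℝ} (he : ∀ j, Measurable (e j)) (he0 : ∀ j x, 0 ≤ e j x)
    {κ : ℝ} {M : ENNReal}
    (h : ∀ j k, j ≠ k → ENNReal.ofReal κ * M ≤
      (∫⁻ x, ENNReal.ofReal (e j x) ∂μ) + ∫⁻ x, ENNReal.ofReal (e k x) ∂μ) :
    ENNReal.ofReal (n / 2 * κ) * M ≤ ∫⁻ x, ENNReal.ofReal (∑ j, e j x) ∂μ := by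
  obtain ⟨m, rfl⟩ := Nat.exists_eq_add_of_le' hn
  set K : Fin (m + 2) → ENNReal := fun j => ∫⁻ x, ENNReal.ofReal (e j x) ∂μ with hK
  have hsum : ∫⁻ x, ENNReal.ofReal (∑ j, e j x) ∂μ = ∑ j, K j := by
    rw [hK, ← lintegral_finsetSum _ fun j _ => (he j).ennreal_ofReal]
    simp only [ENNReal.ofReal_sum_of_nonneg fun j _ => he0 j _]
  have hshift : ∑ j, K (j + 1) = ∑ j, K j := Equiv.sum_comp (Equiv.addRight (1 : Fin (m + 2))) K
  have hle : ∑ _j : Fin (m + 2), ENNReal.ofReal κ * M ≤ ∑ j, (K j + K (j + 1)) :=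
    Finset.sum_le_sum fun j _ => h j (j + 1) (by simp)
  rw [Finset.sum_add_distrib, hshift, ← two_mul, Finset.sum_const, Finset.card_univ,
    Fintype.card_fin, nsmul_eq_mul, ← mul_assoc] at hle
  rw [hsum, ← ENNReal.mul_le_mul_iff_right two_ne_zero ENNReal.ofNat_ne_top]
  refine le_trans (Eq.le ?_) hle
  rw [← mul_assoc]
  congr 1
  rw [← ENNReal.ofReal_ofNat 2, ← ENNReal.ofReal_natCast, ← ENNReal.ofReal_mul zero_le_two,
    ← ENNReal.ofReal_mul (by positivity)]
  congr 1
  ring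

/-- **Lemma (local exclusion principle on a disk).** For `n ≥ 2` anyons and an open disk
`Ω ⊂ ℝ²` of area `|Ω|`,
`∫_{Ω^n} ∑_j |D_j u|² ≥ (n-1) · (0.477 · C_{α,n}²/|Ω|) · ∫_{Ω^n} |u|²`
for every smooth totally symmetric `u` with support away from the diagonals. -/
theorem local_exclusion_disk (α : ℝ) (n : ℕ) (hn : 2 ≤ n)
    (c : ℂ) (r : ℝ) (hr : 0 < r) (Ω : Set ℂ) (hΩ : Ω = Metric.ball c r)
    (u : (Fin n → ℂ) → ℂ)
    (hsmooth : ContDiff ℝ (⊤ : ℕ∞) u)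
    (hsymm : ∀ (σ : Equiv.Perm (Fin n)) (x : Fin n → ℂ), u (x ∘ σ) = u x)
    (hdiag : ∀ x ∈ tsupport u, ∀ j k : Fin n, j ≠ k → x j ≠ x k) :
    ENNReal.ofReal (((n : ℝ) - 1) * (0.477 * statC α n ^ 2 / (volume Ω).toReal)) *
        ∫⁻ x in Set.univ.pi (fun _ : Fin n => Ω), ENNReal.ofReal (‖u x‖ ^ 2) ≤
      ∫⁻ x in Set.univ.pi (fun _ : Fin n => Ω),
        ENNReal.ofReal (∑ j : Fin n, covSq α u j x) := by
  subst hΩ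
  have hu : ContDiff ℝ 1 u := hsmooth.of_le (by norm_cast)
  refine le_trans ?_ (lintegral_sum_ge_of_pair hn (measurable_covSq α hu) (covSq_nonneg α u)
    fun j k hjk => lintegral_covSq_pair_ge hn c hr hu hsymm hjk)
  gcongr ENNReal.ofReal ?_ * _
  have hvol : (volume (Metric.ball c r)).toReal = Real.pi * r ^ 2 := by
    rw [Complex.volume_ball, ENNReal.toReal_mul, ENNReal.toReal_pow, ENNReal.toReal_ofReal hr.le]
    simp [mul_comm]
  have hn1 : (2 : ℝ) ≤ n := by exact_mod_cast hn
  have hπ : 0.477 / Real.pi ≤ 0.3037 / 2 := by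
    rw [div_le_div_iff₀ Real.pi_pos two_pos]
    have := Real.pi_gt_d4
    linarith
  rw [hvol]
  calc ((n : ℝ) - 1) * (0.477 * statC α n ^ 2 / (Real.pi * r ^ 2))
      = (n - 1) * (0.477 / Real.pi) * (statC α n ^ 2 / r ^ 2) := by field_simp
    _ ≤ n * (0.3037 / 2) * (statC α n ^ 2 / r ^ 2) := by gcongr; linarith
    _ = n / 2 * (0.3037 * statC α n ^ 2 / r ^ 2) := by ring

end
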